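/- (General visibility criterion.) Let Ω ⊂ ℝⁿ be a bounded domain, fix a base point x_0 ∈ Ω, and let φ : (0,∞) → (0,∞) be a strictly increasing function with φ(t) → ∞ as t → ∞ such that ∫_0^∞ dt/φ⁻¹(t) < ∞. If k_Ω(x_0, x) ≤ φ(δ_Ω(x_0)/δ_Ω(x)) for all x ∈ Ω, then Ω is a QH-visibility domain. -/

import Mathlib

open Metric Set Filter Topology MeasureTheory
open scoped NNReal ENNReal

noncomputable section

variable {E : Type*} [NormedAddCommGroup E] [NormedSpace ℝ E]

/-- The quasihyperbolic length of a path `γ : [a, b] → Ω`, i.e. `∫ ‖γ'(t)‖ / δ_Ω(γ t) dt`. -/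
def qhLength (Ω : Set E) (γ : ℝ → E) (a b : ℝ) : ℝ :=
  ∫ t in a..b, ‖deriv γ t‖ / infDist (γ t) Ωᶜ

/-- Admissible (Lipschitz, i.e. rectifiable) paths joining `x` to `y` inside `Ω`. -/
def qhAdmissible (Ω : Set E) (x y : E) (γ : ℝ → E) (a b : ℝ) : Prop :=
  a ≤ b ∧ γ a = x ∧ γ b = y ∧ (∀ t ∈ Icc a b, γ t ∈ Ω) ∧
    ∃ K : ℝ≥0, LipschitzOnWith K γ (Icc a b)

/-- The quasihyperbolic distance `k_Ω` on a domain `Ω`. -/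
def qhDist (Ω : Set E) (x y : E) : ℝ :=
  sInf { L : ℝ | ∃ γ a b, qhAdmissible Ω x y γ a b ∧ L = qhLength Ω γ a b }

/-- `γ` is a (unit-speed) quasihyperbolic geodesic on the parameter set `s`. -/
def IsQHGeodesicOn (Ω : Set E) (γ : ℝ → E) (s : Set ℝ) : Prop :=
  (∀ t ∈ s, γ t ∈ Ω) ∧ ∀ a ∈ s, ∀ b ∈ s, qhDist Ω (γ a) (γ b) = |a - b|

/-- `Ω` is a QH-visibility domain: any two distinct Euclidean boundary points have
neighbourhoods with disjoint closures together with a compact subset of `Ω` which is met by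
every quasihyperbolic geodesic joining the two neighbourhoods. -/
def QHVisibilityDomain (Ω : Set E) : Prop :=
  ∀ p ∈ frontier Ω, ∀ q ∈ frontier Ω, p ≠ q →
    ∃ U V : Set E, IsOpen U ∧ IsOpen V ∧ p ∈ U ∧ q ∈ V ∧
      closure U ∩ closure V = ∅ ∧
      ∃ K : Set E, IsCompact K ∧ K ⊆ Ω ∧
        ∀ (γ : ℝ → E) (T : ℝ), 0 ≤ T → IsQHGeodesicOn Ω γ (Icc 0 T) →
          γ 0 ∈ U → γ T ∈ V → ∃ t ∈ Icc 0 T, γ t ∈ K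

/-- The set of quasihyperbolic lengths of admissible paths from `x` to `y`. -/
def qhLengths (Ω : Set E) (x y : E) : Set ℝ :=
  { L : ℝ | ∃ γ a b, qhAdmissible Ω x y γ a b ∧ L = qhLength Ω γ a b }

section Paths

variable {Ω : Set E} {x y z : E} {γ : ℝ → E} {a b : ℝ}

set_option linter.unusedSectionVars false in
lemma infDist_compl_pos (hΩ : IsOpen Ω) (hne : Ωᶜ.Nonempty) (hx : x ∈ Ω) :
    0 < infDist x Ωᶜ :=
  (hΩ.isClosed_compl.notMem_iff_infDist_pos hne).1 fun h => h hx

lemma qhLength_nonneg (hab : a ≤ b) : 0 ≤ qhLength Ω γ a b :=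
  intervalIntegral.integral_nonneg hab fun _ _ => div_nonneg (norm_nonneg _) infDist_nonneg

lemma qhLengths_nonneg {L : ℝ} (hL : L ∈ qhLengths Ω x y) : 0 ≤ L := by
  obtain ⟨γ, a, b, h, rfl⟩ := hL
  exact qhLength_nonneg h.1

lemma qhLengths_bddBelow : BddBelow (qhLengths Ω x y) :=
  ⟨0, fun _ h => qhLengths_nonneg h⟩

lemma LipschitzOnWith.norm_deriv_le_of_mem_Ioo {K : ℝ≥0} (h : LipschitzOnWith K γ (Icc a b))
    {t : ℝ} (ht : t ∈ Ioo a b) : ‖deriv γ t‖ ≤ K :=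
  norm_deriv_le_of_lipschitzOn (Icc_mem_nhds ht.1 ht.2) h

lemma LipschitzOnWith.intervalIntegrable_norm_deriv [CompleteSpace E] {K : ℝ≥0} (hab : a ≤ b)
    (h : LipschitzOnWith K γ (Icc a b)) :
    IntervalIntegrable (fun t => ‖deriv γ t‖) volume a b := by
  borelize E
  rw [intervalIntegrable_iff_integrableOn_Ioo_of_le hab]
  refine Measure.integrableOn_of_bounded (M := K) measure_Ioo_lt_top.ne
    (measurable_deriv γ).norm.aestronglyMeasurable ?_
  filter_upwards [ae_restrict_mem measurableSet_Ioo] with t ht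
  simpa using h.norm_deriv_le_of_mem_Ioo ht

lemma qhAdmissible.intervalIntegrable [CompleteSpace E] (hΩ : IsOpen Ω) (hne : Ωᶜ.Nonempty)
    (h : qhAdmissible Ω x y γ a b) :
    IntervalIntegrable (fun t => ‖deriv γ t‖ / infDist (γ t) Ωᶜ) volume a b := by
  obtain ⟨hab, -, -, hmem, K, hK⟩ := h
  simp only [div_eq_mul_inv]
  refine (hK.intervalIntegrable_norm_deriv hab).mul_continuousOn ?_
  rw [uIcc_of_le hab]
  exact ((continuous_infDist_pt _).comp_continuousOn hK.continuousOn).inv₀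
    fun t ht => (infDist_compl_pos hΩ hne (hmem t ht)).ne'

set_option linter.unusedSectionVars false in
lemma qhAdmissible.shift (h : qhAdmissible Ω x y γ a b) (c : ℝ) :
    qhAdmissible Ω x y (fun t => γ (t - c)) (a + c) (b + c) := by
  obtain ⟨hab, ha, hb, hmem, K, hK⟩ := h
  have hmaps : MapsTo (fun t => t - c) (Icc (a + c) (b + c)) (Icc a b) := fun t ht =>
    ⟨by linarith [ht.1], by linarith [ht.2]⟩
  refine ⟨by linarith, by simpa, by simpa, fun t ht => hmem _ (hmaps ht), K, ?_⟩
  refine LipschitzOnWith.of_dist_le_mul fun s hs t ht => ?_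
  simpa using hK.dist_le_mul _ (hmaps hs) _ (hmaps ht)

lemma qhLength_shift (c : ℝ) :
    qhLength Ω (fun t => γ (t - c)) (a + c) (b + c) = qhLength Ω γ a b := by
  simp only [qhLength, deriv_comp_sub_const]
  rw [intervalIntegral.integral_comp_sub_right (fun t => ‖deriv γ t‖ / infDist (γ t) Ωᶜ)]
  simp

set_option linter.unusedSectionVars false in
lemma qhAdmissible.reverse (h : qhAdmissible Ω x y γ a b) :
    qhAdmissible Ω y x (fun t => γ (-t)) (-b) (-a) := by
  obtain ⟨hab, ha, hb, hmem, K, hK⟩ := h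
  have hmaps : MapsTo (fun t => -t) (Icc (-b) (-a)) (Icc a b) := fun t ht =>
    ⟨by linarith [ht.2], by linarith [ht.1]⟩
  refine ⟨by linarith, by simpa, by simpa, fun t ht => hmem _ (hmaps ht), K, ?_⟩
  refine LipschitzOnWith.of_dist_le_mul fun s hs t ht => ?_
  simpa using hK.dist_le_mul _ (hmaps hs) _ (hmaps ht)

lemma qhLength_reverse : qhLength Ω (fun t => γ (-t)) (-b) (-a) = qhLength Ω γ a b := by
  simp only [qhLength, deriv_comp_neg, norm_neg]
  rw [intervalIntegral.integral_comp_neg (fun t => ‖deriv γ t‖ / infDist (γ t) Ωᶜ)]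
  simp

lemma qhLengths_symm {L : ℝ} (h : L ∈ qhLengths Ω x y) : L ∈ qhLengths Ω y x := by
  obtain ⟨γ, a, b, h, rfl⟩ := h
  exact ⟨_, _, _, h.reverse, qhLength_reverse.symm⟩

lemma qhDist_comm : qhDist Ω x y = qhDist Ω y x :=
  congrArg sInf (Set.ext fun _ => ⟨qhLengths_symm, qhLengths_symm⟩)

set_option linter.unusedSectionVars false in
lemma qhAdmissible.concat {γ' : ℝ → E} {c : ℝ} (h : qhAdmissible Ω x y γ a b)
    (h' : qhAdmissible Ω y z γ' b c) :
    qhAdmissible Ω x z (fun t => if t ≤ b then γ t else γ' t) a c := by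
  obtain ⟨hab, ha, hb, hmem, K, hK⟩ := h
  obtain ⟨hbc, hb', hc, hmem', K', hK'⟩ := h'
  refine ⟨hab.trans hbc, by simpa [hab], ?_, ?_, max K K', ?_⟩
  · dsimp only
    split_ifs with hcb
    · obtain rfl : c = b := le_antisymm hcb hbc
      rw [hb, ← hb', hc]
    · exact hc
  · intro t ht
    dsimp only
    split_ifs with htb
    · exact hmem t ⟨ht.1, htb⟩
    · exact hmem' t ⟨(not_le.1 htb).le, ht.2⟩
  · have hKm : (K : ℝ) ≤ (max K K' : ℝ≥0) := by exact_mod_cast le_max_left K K'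
    have hKm' : (K' : ℝ) ≤ (max K K' : ℝ≥0) := by exact_mod_cast le_max_right K K'
    have key : ∀ s ∈ Icc a c, ∀ t ∈ Icc a c, s ≤ t →
        dist (if s ≤ b then γ s else γ' s) (if t ≤ b then γ t else γ' t)
          ≤ (max K K' : ℝ≥0) * dist s t := by
      intro s hs t ht hst
      by_cases hsb : s ≤ b
      · by_cases htb : t ≤ b
        · rw [if_pos hsb, if_pos htb]
          exact (hK.dist_le_mul s ⟨hs.1, hsb⟩ t ⟨ht.1, htb⟩).trans (by gcongr)
        · rw [if_pos hsb, if_neg htb]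
          have htb := (not_le.1 htb).le
          have h1 := hK.dist_le_mul s ⟨hs.1, hsb⟩ b ⟨hab, le_rfl⟩
          have h2 := hK'.dist_le_mul b ⟨le_rfl, hbc⟩ t ⟨htb, ht.2⟩
          calc dist (γ s) (γ' t) ≤ dist (γ s) (γ b) + dist (γ' b) (γ' t) := by
                rw [hb', ← hb]; exact dist_triangle _ _ _
            _ ≤ K * dist s b + K' * dist b t := add_le_add h1 h2
            _ ≤ (max K K' : ℝ≥0) * dist s b + (max K K' : ℝ≥0) * dist b t := by gcongr
            _ = (max K K' : ℝ≥0) * dist s t := by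
                rw [← mul_add, Real.dist_eq, Real.dist_eq, Real.dist_eq,
                  abs_of_nonpos (by linarith), abs_of_nonpos (by linarith),
                  abs_of_nonpos (by linarith)]
                ring
      · have htb : ¬ t ≤ b := fun h => hsb (hst.trans h)
        rw [if_neg hsb, if_neg htb]
        exact (hK'.dist_le_mul s ⟨(not_le.1 hsb).le, hs.2⟩ t ⟨(not_le.1 htb).le, ht.2⟩).trans
          (by gcongr)
    refine LipschitzOnWith.of_dist_le_mul fun s hs t ht => ?_
    rcases le_total s t with hst | hst
    · exact key s hs t ht hst
    · rw [dist_comm, dist_comm s t]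
      exact key t ht s hs hst

lemma qhLength_concat [CompleteSpace E] (hΩ : IsOpen Ω) (hne : Ωᶜ.Nonempty) {γ' : ℝ → E} {c : ℝ}
    (h : qhAdmissible Ω x y γ a b) (h' : qhAdmissible Ω y z γ' b c) :
    qhLength Ω (fun t => if t ≤ b then γ t else γ' t) a c
      = qhLength Ω γ a b + qhLength Ω γ' b c := by
  have hint := (h.concat h').intervalIntegrable hΩ hne
  have hab := h.1
  have hbc := h'.1
  unfold qhLength
  rw [← intervalIntegral.integral_add_adjacent_intervals (b := b)]
  · congr 1
    · rw [intervalIntegral.integral_of_le hab, intervalIntegral.integral_of_le hab,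
        integral_Ioc_eq_integral_Ioo, integral_Ioc_eq_integral_Ioo]
      refine setIntegral_congr_fun measurableSet_Ioo fun t ht => ?_
      have heq : (fun t => if t ≤ b then γ t else γ' t) =ᶠ[𝓝 t] γ := by
        filter_upwards [Iio_mem_nhds ht.2] with s hs
        exact if_pos (le_of_lt hs)
      simp only [heq.deriv_eq, if_pos ht.2.le]
    · rw [intervalIntegral.integral_of_le hbc, intervalIntegral.integral_of_le hbc]
      refine setIntegral_congr_fun measurableSet_Ioc fun t ht => ?_
      have heq : (fun t => if t ≤ b then γ t else γ' t) =ᶠ[𝓝 t] γ' := by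
        filter_upwards [Ioi_mem_nhds ht.1] with s hs
        exact if_neg (not_le.2 hs)
      simp only [heq.deriv_eq, if_neg (not_le.2 ht.1)]
  · refine hint.mono_set ?_
    rw [uIcc_of_le hab, uIcc_of_le (hab.trans hbc)]
    exact Icc_subset_Icc_right hbc
  · refine hint.mono_set ?_
    rw [uIcc_of_le hbc, uIcc_of_le (hab.trans hbc)]
    exact Icc_subset_Icc_left hab

lemma add_mem_qhLengths [CompleteSpace E] (hΩ : IsOpen Ω) (hne : Ωᶜ.Nonempty) {L L' : ℝ}
    (h : L ∈ qhLengths Ω x y) (h' : L' ∈ qhLengths Ω y z) : L + L' ∈ qhLengths Ω x z := by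
  obtain ⟨γ, a, b, h, rfl⟩ := h
  obtain ⟨γ', a', b', h', rfl⟩ := h'
  have hs := h'.shift (b - a')
  have hl := qhLength_shift (Ω := Ω) (γ := γ') (a := a') (b := b') (b - a')
  rw [add_sub_cancel] at hs hl
  exact ⟨_, _, _, h.concat hs, by rw [qhLength_concat hΩ hne h hs, hl]⟩

lemma qhLengths_nonempty [CompleteSpace E] (hΩ : IsOpen Ω) (hconn : IsPreconnected Ω)
    (hne : Ωᶜ.Nonempty) (hx : x ∈ Ω) (hy : y ∈ Ω) : (qhLengths Ω x y).Nonempty := by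
  refine hconn.induction₂ (fun x y => (qhLengths Ω x y).Nonempty) ?_ ?_ ?_ hx hy
  · intro x hx
    obtain ⟨r, hr, hball⟩ := Metric.isOpen_iff.1 hΩ x hx
    filter_upwards [mem_nhdsWithin_of_mem_nhds (ball_mem_nhds x hr)] with y hy
    refine ⟨_, fun t => AffineMap.lineMap x y t, 0, 1, ⟨zero_le_one, by simp, by simp, ?_, ?_⟩, rfl⟩
    · intro t ht
      refine hball ((convex_ball x r).segment_subset (mem_ball_self hr) hy ?_)
      rw [segment_eq_image_lineMap]
      exact mem_image_of_mem _ ht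
    · exact ⟨_, (lipschitzWith_lineMap x y).lipschitzOnWith⟩
  · rintro x y z - - - ⟨L, hL⟩ ⟨L', hL'⟩
    exact ⟨_, add_mem_qhLengths hΩ hne hL hL'⟩
  · rintro x y - - ⟨L, hL⟩
    exact ⟨L, qhLengths_symm hL⟩

lemma qhDist_triangle [CompleteSpace E] (hΩ : IsOpen Ω) (hconn : IsPreconnected Ω)
    (hne : Ωᶜ.Nonempty) (hx : x ∈ Ω) (hy : y ∈ Ω) (hz : z ∈ Ω) :
    qhDist Ω x z ≤ qhDist Ω x y + qhDist Ω y z := by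
  refine le_of_forall_pos_le_add fun ε hε => ?_
  obtain ⟨L, hL, hLlt⟩ := Real.lt_sInf_add_pos (qhLengths_nonempty hΩ hconn hne hx hy) (half_pos hε)
  obtain ⟨L', hL', hLlt'⟩ :=
    Real.lt_sInf_add_pos (qhLengths_nonempty hΩ hconn hne hy hz) (half_pos hε)
  have h := csInf_le qhLengths_bddBelow (add_mem_qhLengths hΩ hne hL hL')
  change sInf (qhLengths Ω x z) ≤ sInf (qhLengths Ω x y) + sInf (qhLengths Ω y z) + ε
  linarith

lemma HasDerivAt.norm_le_of_dist_le {f : ℝ → ℝ} {f' t : ℝ} {γ' : E} (hf : HasDerivAt f f' t)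
    (hγ : HasDerivAt γ γ' t) (h : ∀ s, |f s - f t| ≤ ‖γ s - γ t‖) : |f'| ≤ ‖γ'‖ := by
  refine le_of_tendsto_of_tendsto' (hasDerivAt_iff_tendsto_slope.1 hf).norm
    (hasDerivAt_iff_tendsto_slope.1 hγ).norm fun s => ?_
  simp only [slope_def_module, norm_smul]
  gcongr
  exact h s

lemma qhAdmissible.log_le_qhLength [FiniteDimensional ℝ E] (hΩ : IsOpen Ω) (hne : Ωᶜ.Nonempty)
    (h : qhAdmissible Ω x y γ a b) :
    Real.log (infDist x Ωᶜ + ‖y - x‖) - Real.log (infDist x Ωᶜ) ≤ qhLength Ω γ a b := by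
  have hint := h.intervalIntegrable hΩ hne
  obtain ⟨hab, rfl, rfl, hmem, K, hK⟩ := h
  set d := infDist (γ a) Ωᶜ with hd
  have hd0 : 0 < d := infDist_compl_pos hΩ hne (hmem a ⟨le_rfl, hab⟩)
  let f : ℝ → ℝ := fun t => d + ‖γ t - γ a‖
  have hfpos : ∀ t, d ≤ f t := fun t => le_add_of_nonneg_right (norm_nonneg _)
  have hf0 : ∀ t, 0 < f t := fun t => hd0.trans_le (hfpos t)
  have hfdist : ∀ s t, |f s - f t| ≤ ‖γ s - γ t‖ := fun s t => by
    simpa [f] using abs_norm_sub_norm_le (γ s - γ a) (γ t - γ a)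
  have hlogle : ∀ s t, Real.log (f s) - Real.log (f t) ≤ d⁻¹ * |f s - f t| := by
    intro s t
    rw [← Real.log_div (hf0 s).ne' (hf0 t).ne']
    calc Real.log (f s / f t) ≤ f s / f t - 1 :=
          Real.log_le_sub_one_of_pos (div_pos (hf0 s) (hf0 t))
      _ = (f t)⁻¹ * (f s - f t) := by field_simp [(hf0 t).ne']
      _ ≤ (f t)⁻¹ * |f s - f t| := by have := hf0 t; gcongr; exact le_abs_self _
      _ ≤ d⁻¹ * |f s - f t| := by gcongr; exact hfpos t
  have hlip : LipschitzOnWith (Real.toNNReal d⁻¹ * K) (fun t => Real.log (f t)) (uIcc a b) := by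
    rw [uIcc_of_le hab]
    refine LipschitzOnWith.of_dist_le_mul fun s hs t ht => ?_
    have h1 : |Real.log (f s) - Real.log (f t)| ≤ d⁻¹ * |f s - f t| :=
      abs_sub_le_iff.2 ⟨hlogle s t, by rw [abs_sub_comm]; exact hlogle t s⟩
    have h2 := hK.dist_le_mul s hs t ht
    rw [dist_eq_norm] at h2
    rw [NNReal.coe_mul, Real.coe_toNNReal _ (inv_pos.2 hd0).le, Real.dist_eq, mul_assoc]
    exact h1.trans (by gcongr; exact (hfdist s t).trans h2)
  have hac := hlip.absolutelyContinuousOnInterval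
  have hftc := hac.integral_deriv_eq_sub
  have hfa : f a = d := by simp [f]
  rw [hfa] at hftc
  rw [show d + ‖γ b - γ a‖ = f b from rfl, ← hftc]
  refine intervalIntegral.integral_mono_ae_restrict hab hac.intervalIntegrable_deriv hint ?_
  have hne' : ∀ᵐ t : ℝ, t ≠ a ∧ t ≠ b := by
    filter_upwards [Measure.ae_ne volume a, Measure.ae_ne volume b] with t h1 h2
    exact ⟨h1, h2⟩
  filter_upwards [hK.ae_differentiableWithinAt_real measurableSet_Icc, ae_restrict_of_ae hne',
    ae_restrict_mem measurableSet_Icc] with t hγt htne ht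
  have hnhds : Icc a b ∈ 𝓝 t :=
    Icc_mem_nhds (lt_of_le_of_ne ht.1 (Ne.symm htne.1)) (lt_of_le_of_ne ht.2 htne.2)
  have hγd := (hγt.differentiableAt hnhds).hasDerivAt
  have hδ : 0 < infDist (γ t) Ωᶜ := infDist_compl_pos hΩ hne (hmem t ht)
  have hδf : infDist (γ t) Ωᶜ ≤ f t := by
    simpa [f, dist_eq_norm, hd] using infDist_le_infDist_add_dist (s := Ωᶜ) (x := γ t) (y := γ a)
  by_cases hdiff : DifferentiableAt ℝ (fun t => Real.log (f t)) t
  · have hexp : HasDerivAt f (f t * deriv (fun t => Real.log (f t)) t) t := by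
      have := hdiff.hasDerivAt.exp
      simpa only [Real.exp_log (hf0 _)] using this
    have hle := hexp.norm_le_of_dist_le hγd fun s => hfdist s t
    rw [abs_mul, abs_of_pos (hf0 t)] at hle
    calc deriv (fun t => Real.log (f t)) t ≤ |deriv (fun t => Real.log (f t)) t| := le_abs_self _
      _ ≤ ‖deriv γ t‖ / f t := by rw [le_div_iff₀' (hf0 t)]; exact hle
      _ ≤ ‖deriv γ t‖ / infDist (γ t) Ωᶜ := by gcongr
  · rw [deriv_zero_of_not_differentiableAt hdiff]
    positivity

lemma log_le_qhDist [FiniteDimensional ℝ E] (hΩ : IsOpen Ω) (hconn : IsPreconnected Ω)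
    (hne : Ωᶜ.Nonempty) (hx : x ∈ Ω) (hy : y ∈ Ω) :
    Real.log (infDist x Ωᶜ + ‖y - x‖) - Real.log (infDist x Ωᶜ) ≤ qhDist Ω x y := by
  have := FiniteDimensional.complete ℝ E
  refine le_csInf (qhLengths_nonempty hΩ hconn hne hx hy) ?_
  rintro _ ⟨γ, a, b, h, rfl⟩
  exact h.log_le_qhLength hΩ hne

lemma norm_sub_le_infDist_mul_exp_qhDist [FiniteDimensional ℝ E] (hΩ : IsOpen Ω)
    (hconn : IsPreconnected Ω) (hne : Ωᶜ.Nonempty) (hx : x ∈ Ω) (hy : y ∈ Ω) :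
    ‖y - x‖ ≤ infDist x Ωᶜ * (Real.exp (qhDist Ω x y) - 1) := by
  have hd := infDist_compl_pos hΩ hne hx
  have h := log_le_qhDist hΩ hconn hne hx hy
  rw [← Real.log_div (by positivity) hd.ne', Real.log_le_iff_le_exp (by positivity),
    div_le_iff₀ hd] at h
  linarith

lemma log_infDist_div_le_qhDist [FiniteDimensional ℝ E] (hΩ : IsOpen Ω)
    (hconn : IsPreconnected Ω) (hne : Ωᶜ.Nonempty) (hx : x ∈ Ω) (hy : y ∈ Ω) :
    Real.log (infDist x Ωᶜ / infDist y Ωᶜ) ≤ qhDist Ω x y := by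
  have hdx := infDist_compl_pos hΩ hne hx
  have hdy := infDist_compl_pos hΩ hne hy
  rw [qhDist_comm, Real.log_div hdx.ne' hdy.ne']
  refine le_trans ?_ (log_le_qhDist hΩ hconn hne hy hx)
  gcongr
  rw [← dist_eq_norm]
  exact infDist_le_infDist_add_dist

end Paths

set_option linter.unusedSectionVars false in
lemma norm_sub_le_of_local {F : ℝ → E} {G : ℝ → ℝ} {R : ℝ}
    (h : ∀ s t, 0 ≤ s → s ≤ t → t ≤ R → t - s ≤ 1 → ‖F t - F s‖ ≤ G t - G s)
    (hR : 0 ≤ R) : ‖F R - F 0‖ ≤ G R - G 0 := by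
  have key : ∀ n : ℕ, ∀ t, 0 ≤ t → t ≤ R → t ≤ n → ‖F t - F 0‖ ≤ G t - G 0 := by
    intro n
    induction n with
    | zero =>
      intro t h0 _ hn
      obtain rfl : t = 0 := le_antisymm (by simpa using hn) h0
      simp
    | succ n ih =>
      intro t h0 hR hn
      push_cast at hn
      rcases le_total t 1 with h1 | h1
      · exact h 0 t le_rfl h0 hR (by linarith)
      · have h2 := ih (t - 1) (by linarith) (by linarith) (by linarith)
        have h3 := h (t - 1) t (by linarith) (by linarith) hR (by linarith)
        calc ‖F t - F 0‖ ≤ ‖F t - F (t - 1)‖ + ‖F (t - 1) - F 0‖ :=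
              norm_sub_le_norm_sub_add_norm_sub ..
          _ ≤ _ := by linarith
  obtain ⟨n, hn⟩ := exists_nat_ge R
  exact key n R hR le_rfl hn

/-- A quasihyperbolic geodesic along which the distance to the boundary is bounded by an antitone
function `h` has Euclidean displacement at most `2 ∫ h`. -/
lemma norm_sub_le_two_mul_integral [FiniteDimensional ℝ E] {Ω : Set E} (hΩ : IsOpen Ω)
    (hconn : IsPreconnected Ω) (hne : Ωᶜ.Nonempty) {F : ℝ → E} {h : ℝ → ℝ} {R : ℝ} (hR : 0 ≤ R)
    (hF : IsQHGeodesicOn Ω F (Icc 0 R)) (hh : AntitoneOn h (Icc 0 R))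
    (hδ : ∀ t ∈ Icc 0 R, infDist (F t) Ωᶜ ≤ h t) :
    ‖F R - F 0‖ ≤ 2 * ∫ t in 0..R, h t := by
  have hint : ∀ s t, 0 ≤ s → s ≤ t → t ≤ R → IntervalIntegrable h volume s t := by
    intro s t hs hst ht
    refine AntitoneOn.intervalIntegrable (hh.mono ?_)
    rw [uIcc_of_le hst]
    exact Icc_subset_Icc hs ht
  have key := norm_sub_le_of_local (F := F) (G := fun t => 2 * ∫ u in 0..t, h u) ?_ hR
  · simpa using key
  intro s t hs hst ht hts
  have hsm : s ∈ Icc 0 R := ⟨hs, hst.trans ht⟩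
  have htm : t ∈ Icc 0 R := ⟨hs.trans hst, ht⟩
  have h1 := norm_sub_le_infDist_mul_exp_qhDist hΩ hconn hne (hF.1 t htm) (hF.1 s hsm)
  rw [hF.2 t htm s hsm, abs_of_nonneg (sub_nonneg.2 hst), norm_sub_rev] at h1
  have h2 : Real.exp (t - s) - 1 ≤ 2 * (t - s) := by
    have := Real.abs_exp_sub_one_le (x := t - s) (by rwa [abs_of_nonneg (sub_nonneg.2 hst)])
    rw [abs_of_nonneg (sub_nonneg.2 hst)] at this
    exact (le_abs_self _).trans this
  have h3 : (t - s) * h t ≤ ∫ u in s..t, h u := by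
    rw [← smul_eq_mul, ← intervalIntegral.integral_const]
    refine intervalIntegral.integral_mono_on hst (by simp) (hint s t hs hst ht) fun u hu => ?_
    exact hh ⟨hs.trans hu.1, hu.2.trans ht⟩ htm hu.2
  have h4 : (∫ u in 0..t, h u) - ∫ u in 0..s, h u = ∫ u in s..t, h u :=
    intervalIntegral.integral_interval_sub_left (hint 0 t le_rfl htm.1 ht)
      (hint 0 s le_rfl hs hsm.2)
  have h5 : infDist (F t) Ωᶜ * (Real.exp (t - s) - 1) ≤ h t * (2 * (t - s)) :=
    mul_le_mul (hδ t htm) h2 (by simpa using hst) (infDist_nonneg.trans (hδ t htm))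
  rw [← mul_sub, h4]
  linarith

/-- The half-length estimate: a geodesic starting at its point closest to `x₀` and staying far from
`x₀` has displacement controlled by the tail of `∫ 1 / ψ`. -/
lemma norm_sub_le_of_forall_le_qhDist [FiniteDimensional ℝ E] {Ω : Set E} (hΩ : IsOpen Ω)
    (hconn : IsPreconnected Ω) (hne : Ωᶜ.Nonempty) {x₀ : E} (hx₀ : x₀ ∈ Ω) {φ ψ : ℝ → ℝ}
    (hψmono : MonotoneOn ψ (Ioi 0)) (hψinv : ∀ s ∈ Ioi (0 : ℝ), ψ (φ s) = s)
    (hint : IntegrableOn (fun t => 1 / ψ t) (Ioi 0))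
    (hgrowth : ∀ x ∈ Ω, qhDist Ω x₀ x ≤ φ (infDist x₀ Ωᶜ / infDist x Ωᶜ))
    {A : ℝ} (hA : 0 < A) (hψA : 0 < ψ A) {F : ℝ → E} {R : ℝ} (hR : 0 ≤ R)
    (hF : IsQHGeodesicOn Ω F (Icc 0 R))
    (hfar : ∀ u ∈ Icc 0 R, u / 4 + A ≤ qhDist Ω x₀ (F u)) :
    ‖F R - F 0‖ ≤ 8 * infDist x₀ Ωᶜ * ∫ t in Ioi A, 1 / ψ t := by
  have hd := infDist_compl_pos hΩ hne hx₀
  have hψpos : ∀ s, A ≤ s → 0 < ψ s := fun s hs => hψA.trans_le (hψmono hA (hA.trans_le hs) hs)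
  have hle := norm_sub_le_two_mul_integral (h := fun u => infDist x₀ Ωᶜ * (1 / ψ (u / 4 + A)))
    hΩ hconn hne hR hF ?_ ?_
  · have hsub : ∫ u in 0..R, 1 / ψ (u / 4 + A) = 4 * ∫ t in A..(R / 4 + A), 1 / ψ t := by
      rw [intervalIntegral.integral_comp_div_add (fun t => 1 / ψ t) (by norm_num)]
      simp
    have htail : ∫ t in A..(R / 4 + A), 1 / ψ t ≤ ∫ t in Ioi A, 1 / ψ t := by
      rw [intervalIntegral.integral_of_le (by linarith)]
      refine setIntegral_mono_set (hint.mono_set (Ioi_subset_Ioi hA.le)) ?_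
        Ioc_subset_Ioi_self.eventuallyLE
      filter_upwards [ae_restrict_mem measurableSet_Ioi] with t ht
      exact (one_div_pos.2 (hψpos t (le_of_lt ht))).le
    rw [intervalIntegral.integral_const_mul, hsub] at hle
    calc _ ≤ _ := hle
      _ = 8 * infDist x₀ Ωᶜ * ∫ t in A..(R / 4 + A), 1 / ψ t := by ring
      _ ≤ _ := by gcongr
  · intro s hs t ht hst
    have h1 : A ≤ s / 4 + A := by linarith [hs.1]
    have h2 : ψ (s / 4 + A) ≤ ψ (t / 4 + A) :=
      hψmono (hA.trans_le h1) (hA.trans_le (by linarith)) (by linarith)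
    have := hψpos _ h1
    dsimp only
    gcongr
  · intro t ht
    have hδ := infDist_compl_pos hΩ hne (hF.1 t ht)
    have hA' : A ≤ t / 4 + A := by linarith [ht.1]
    have h1 := (hfar t ht).trans (hgrowth _ (hF.1 t ht))
    have h2 := hψmono (hA.trans_le hA') ((hA.trans_le hA').trans_le h1) h1
    rw [hψinv _ (div_pos hd hδ), le_div_iff₀ hδ] at h2
    rw [mul_one_div, le_div_iff₀ (hψpos _ hA')]
    linarith

/-- **General visibility criterion.** Let `Ω ⊆ ℝⁿ` be a bounded domain,
`x₀ ∈ Ω`, and `φ : (0,∞) → (0,∞)` strictly increasing with `φ(t) → ∞` as `t → ∞`, whose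
inverse `ψ = φ⁻¹` satisfies `∫_0^∞ dt / φ⁻¹(t) < ∞`. If
`k_Ω(x₀, x) ≤ φ(δ_Ω(x₀) / δ_Ω(x))` for all `x ∈ Ω`, then `Ω` is a QH-visibility domain. -/
theorem statement7 {n : ℕ} (Ω : Set (EuclideanSpace ℝ (Fin n)))
    (hOpen : IsOpen Ω) (hConn : IsConnected Ω) (hBdd : Bornology.IsBounded Ω)
    (x₀ : EuclideanSpace ℝ (Fin n)) (hx₀ : x₀ ∈ Ω)
    (φ ψ : ℝ → ℝ)
    (hφmono : StrictMonoOn φ (Ioi 0))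
    (hφpos : ∀ t ∈ Ioi (0 : ℝ), 0 < φ t)
    (hφtop : Tendsto φ atTop atTop)
    (hψmono : MonotoneOn ψ (Ioi 0))
    (hψinv : ∀ s ∈ Ioi (0 : ℝ), ψ (φ s) = s)
    (hint : IntegrableOn (fun t => 1 / ψ t) (Ioi 0))
    (hgrowth : ∀ x ∈ Ω, qhDist Ω x₀ x ≤ φ (infDist x₀ Ωᶜ / infDist x Ωᶜ)) :
    QHVisibilityDomain Ω := by
  intro p hp q hq hpq
  have hpne : p ∈ Ωᶜ := fun h => (hOpen.frontier_eq ▸ hp : p ∈ closure Ω \ Ω).2 h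
  have hne : Ωᶜ.Nonempty := ⟨p, hpne⟩
  have hconn := hConn.isPreconnected
  have hd := infDist_compl_pos hOpen hne hx₀
  set d := infDist x₀ Ωᶜ
  have hr : 0 < dist p q / 4 := by have := dist_pos.2 hpq; positivity
  set r := dist p q / 4 with hr_def
  obtain ⟨A, hAφ, hAint⟩ : ∃ A, φ 1 ≤ A ∧ ∫ t in Ioi A, 1 / ψ t < r / (8 * d) := by
    have h1 : Tendsto (fun A : ℝ => ∫ t in Ioi A, 1 / ψ t) atTop (𝓝 0) :=
      tendsto_integral_Ioi_zero tendsto_id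
    exact ((eventually_ge_atTop (φ 1)).and
      (h1.eventually (gt_mem_nhds (by positivity : 0 < r / (8 * d))))).exists
  have hφ1 : 0 < φ 1 := hφpos 1 (mem_Ioi.2 one_pos)
  have hA : 0 < A := hφ1.trans_le hAφ
  have hψA : 0 < ψ A := by
    have := hψmono hφ1 hA hAφ
    rw [hψinv 1 (mem_Ioi.2 one_pos)] at this
    linarith
  set η := d * Real.exp (-(2 * A))
  have hη : 0 < η := by positivity
  refine ⟨ball p r, ball q r, isOpen_ball, isOpen_ball, mem_ball_self hr, mem_ball_self hr, ?_,
    {x | η ≤ infDist x Ωᶜ}, ?_, ?_, ?_⟩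
  · refine (Disjoint.mono closure_ball_subset_closedBall closure_ball_subset_closedBall
      (closedBall_disjoint_closedBall ?_)).inter_eq
    linarith
  · have hsub : {x | η ≤ infDist x Ωᶜ} ⊆ Ω := fun x hx => by
      by_contra hxΩ
      rw [mem_ofPred_eq, infDist_zero_of_mem hxΩ] at hx
      linarith
    exact Metric.isCompact_of_isClosed_isBounded
      (isClosed_le continuous_const (continuous_infDist_pt _)) (hBdd.subset hsub)
  · intro x hx
    by_contra hxΩ
    rw [mem_ofPred_eq, infDist_zero_of_mem hxΩ] at hx
    linarith
  intro γ T hT hγ hγ0 hγT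
  by_contra! hK
  have hfar : ∀ t ∈ Icc 0 T, 2 * A ≤ qhDist Ω x₀ (γ t) := by
    intro t ht
    have hδ := infDist_compl_pos hOpen hne (hγ.1 t ht)
    refine le_trans ?_ (log_infDist_div_le_qhDist hOpen hconn hne hx₀ (hγ.1 t ht))
    rw [Real.le_log_iff_exp_le (by positivity), le_div_iff₀ hδ]
    have h1 : infDist (γ t) Ωᶜ < d * Real.exp (-(2 * A)) := not_le.1 (hK t ht)
    calc Real.exp (2 * A) * infDist (γ t) Ωᶜ
        ≤ Real.exp (2 * A) * (d * Real.exp (-(2 * A))) := by gcongr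
      _ = d := by rw [Real.exp_neg]; field_simp
  have hcont : ContinuousOn (fun t => qhDist Ω x₀ (γ t)) (Icc 0 T) := by
    refine (LipschitzOnWith.of_le_add fun s hs t ht => ?_).continuousOn
    rw [Real.dist_eq, abs_sub_comm, ← hγ.2 t ht s hs]
    exact qhDist_triangle hOpen hconn hne hx₀ (hγ.1 t ht) (hγ.1 s hs)
  obtain ⟨t₀, ht₀, hmin⟩ := isCompact_Icc.exists_isMinOn (nonempty_Icc.2 hT) hcont
  have hfar' : ∀ t ∈ Icc 0 T, |t₀ - t| / 4 + A ≤ qhDist Ω x₀ (γ t) := by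
    intro t ht
    have h1 : qhDist Ω x₀ (γ t₀) ≤ qhDist Ω x₀ (γ t) := hmin ht
    have h2 := qhDist_triangle hOpen hconn hne (hγ.1 t₀ ht₀) hx₀ (hγ.1 t ht)
    rw [hγ.2 t₀ ht₀ t ht, qhDist_comm] at h2
    linarith [hfar t ht]
  have hright : ‖γ T - γ t₀‖ ≤ 8 * d * ∫ t in Ioi A, 1 / ψ t := by
    have hmaps : ∀ u ∈ Icc 0 (T - t₀), t₀ + u ∈ Icc 0 T := fun u hu =>
      ⟨by linarith [hu.1, ht₀.1], by linarith [hu.2]⟩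
    have := norm_sub_le_of_forall_le_qhDist (F := fun u => γ (t₀ + u)) (R := T - t₀) hOpen hconn hne
      hx₀ hψmono hψinv hint hgrowth hA hψA (sub_nonneg.2 ht₀.2)
      ⟨fun u hu => hγ.1 _ (hmaps u hu), fun u hu v hv => by
        rw [hγ.2 _ (hmaps u hu) _ (hmaps v hv)]; congr 1; ring⟩
      fun u hu => by
        have := hfar' _ (hmaps u hu)
        rwa [sub_add_cancel_left, abs_neg, abs_of_nonneg hu.1] at this
    simpa using this
  have hleft : ‖γ 0 - γ t₀‖ ≤ 8 * d * ∫ t in Ioi A, 1 / ψ t := by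
    have hmaps : ∀ u ∈ Icc 0 t₀, t₀ - u ∈ Icc 0 T := fun u hu =>
      ⟨by linarith [hu.2], by linarith [hu.1, ht₀.2]⟩
    have := norm_sub_le_of_forall_le_qhDist (F := fun u => γ (t₀ - u)) (R := t₀) hOpen hconn hne
      hx₀ hψmono hψinv hint hgrowth hA hψA ht₀.1
      ⟨fun u hu => hγ.1 _ (hmaps u hu), fun u hu v hv => by
        rw [hγ.2 _ (hmaps u hu) _ (hmaps v hv), abs_sub_comm u v]; congr 1; ring⟩
      fun u hu => by
        have := hfar' _ (hmaps u hu)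
        rwa [sub_sub_cancel, abs_of_nonneg hu.1] at this
    simpa using this
  have hsmall : 8 * d * ∫ t in Ioi A, 1 / ψ t < r := by
    rwa [lt_div_iff₀' (by positivity)] at hAint
  rw [← dist_eq_norm] at hright hleft
  rw [mem_ball] at hγ0 hγT
  have h1 := dist_triangle4 p (γ 0) (γ T) q
  have h2 := dist_triangle_right (γ 0) (γ T) (γ t₀)
  rw [dist_comm p (γ 0)] at h1
  linarith

end
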